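/- arXiv:1904.12345 — 2 statements merged into one kernel-verified Lean document; each statement's English description precedes it below -/
import Mathlib

section
/- Let g ∈ L²(ℝ), let Λ ⊆ ℝ² be a lattice, and set 𝒢 = 𝒢(g, Λ). Then: (1) for every z ∈ ℝ², z ∈ 𝔍(𝒢) if and only if π(z)g ∈ 𝒢; and (2) 𝔍(𝒢) is a closed additive subgroup of ℝ², i.e. it is a closed subset of ℝ² containing 0 that is closed under addition and under negation. -/
open MeasureTheory Complex Filter
open scoped ENNReal InnerProductSpace RealInnerProductSpace ComplexConjugate

noncomputable section

/-- The Hilbert space `L²(ℝ)` of complex-valued square-integrable functions. -/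
abbrev L2 : Type := Lp ℂ 2 (volume : Measure ℝ)

lemma memLp_translate (a : ℝ) (f : L2) :
    MemLp (fun x : ℝ => f (x - a)) 2 (volume : Measure ℝ) :=
  (Lp.memLp f).comp_measurePreserving (measurePreserving_sub_right volume a)

lemma memLp_modulate (b : ℝ) (f : L2) :
    MemLp (fun x : ℝ => Complex.exp (2 * Real.pi * Complex.I * (b * x)) * f x) 2
      (volume : Measure ℝ) := by
  refine MemLp.of_le (Lp.memLp f) ?_ ?_
  · exact (Complex.continuous_exp.comp (by fun_prop)).aestronglyMeasurable.mul
      (Lp.aestronglyMeasurable f)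
  · filter_upwards with x
    have : Complex.exp (2 * Real.pi * Complex.I * (b * x))
        = Complex.exp ((2 * Real.pi * (b * x) : ℝ) * Complex.I) := by
      push_cast; ring_nf
    rw [norm_mul, this, Complex.norm_exp_ofReal_mul_I, one_mul]

/-- Translation `T_a` on `L²(ℝ)`: `(T_a f)(x) = f (x - a)`. -/
def Tr (a : ℝ) (f : L2) : L2 := (memLp_translate a f).toLp _

/-- Modulation `M_b` on `L²(ℝ)`: `(M_b f)(x) = e^{2πibx} f x`. -/
def Mo (b : ℝ) (f : L2) : L2 := (memLp_modulate b f).toLp _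

/-- Time-frequency shift `π(a,b) = T_a M_b`. -/
def tf (z : ℝ × ℝ) (f : L2) : L2 := Tr z.1 (Mo z.2 f)

/-- The closed linear span `𝒢(g,Λ)` of the Gabor system `(g,Λ)`. -/
def gaborSpan (g : L2) (Λ : Set (ℝ × ℝ)) : Set L2 :=
  closure (Submodule.span ℂ ((fun z => tf z g) '' Λ) : Set L2)

/-- `𝔍(𝒢)`: the set of time-frequency shifts leaving `𝒢` invariant. -/
def stab (G : Set L2) : Set (ℝ × ℝ) := {z | ∀ f ∈ G, tf z f ∈ G}

/-- `Λ` is a lattice in `ℝ²` if `Λ = Aℤ²` for an invertible `2×2` matrix `A`. -/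
def IsLattice (Λ : Set (ℝ × ℝ)) : Prop :=
  ∃ A : Matrix (Fin 2) (Fin 2) ℝ, IsUnit A.det ∧
    Λ = {p : ℝ × ℝ | ∃ k l : ℤ,
      p = (A 0 0 * k + A 0 1 * l, A 1 0 * k + A 1 1 * l)}

lemma memLp_gaussian : MemLp (fun x : ℝ => (Real.exp (-Real.pi * x ^ 2) : ℂ)) 2
    (volume : Measure ℝ) := by
  rw [memLp_two_iff_integrable_sq_norm]
  · have h : Integrable (fun x : ℝ => Real.exp (-(2 * Real.pi) * x ^ 2)) volume :=
      integrable_exp_neg_mul_sq (by positivity)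
    refine h.congr (Eventually.of_forall fun x => ?_)
    simp only [Complex.norm_real, Real.norm_eq_abs, Real.abs_exp, sq, ← Real.exp_add]
    ring_nf
  · exact (Complex.continuous_ofReal.comp (by fun_prop)).aestronglyMeasurable

/-- The Gaussian `φ(x) = e^{-πx²}` as an element of `L²(ℝ)`. -/
def gaussL2 : L2 := memLp_gaussian.toLp _

/-- The Feichtinger algebra condition: `f ∈ S₀(ℝ)` iff `(a,b) ↦ ⟨f, π(a,b)φ⟩ ∈ L¹(ℝ²)`. -/
def InS0 (f : L2) : Prop :=
  Integrable (fun z : ℝ × ℝ => ⟪tf z gaussL2, f⟫_ℂ) (volume : Measure (ℝ × ℝ))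

/-- `(g,Λ)` is a frame for its closed linear span. -/
def IsFrameSeq (g : L2) (Λ : Set (ℝ × ℝ)) : Prop :=
  ∃ A B : ℝ, 0 < A ∧ 0 < B ∧ ∀ f ∈ gaborSpan g Λ,
    A * ‖f‖ ^ 2 ≤ ∑' lam : Λ, ‖⟪tf (lam : ℝ × ℝ) g, f⟫_ℂ‖ ^ 2 ∧
    ∑' lam : Λ, ‖⟪tf (lam : ℝ × ℝ) g, f⟫_ℂ‖ ^ 2 ≤ B * ‖f‖ ^ 2

/-- `(g,Λ)` is a frame for all of `L²(ℝ)`. -/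
def IsFrameL2 (g : L2) (Λ : Set (ℝ × ℝ)) : Prop :=
  ∃ A B : ℝ, 0 < A ∧ 0 < B ∧ ∀ f : L2,
    A * ‖f‖ ^ 2 ≤ ∑' lam : Λ, ‖⟪tf (lam : ℝ × ℝ) g, f⟫_ℂ‖ ^ 2 ∧
    ∑' lam : Λ, ‖⟪tf (lam : ℝ × ℝ) g, f⟫_ℂ‖ ^ 2 ≤ B * ‖f‖ ^ 2

/-- Euclidean ball of radius `ε` around `a ∈ ℝ²`. -/
def eball (ε : ℝ) (a : ℝ × ℝ) : Set (ℝ × ℝ) :=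
  {x : ℝ × ℝ | Real.sqrt ((x.1 - a.1) ^ 2 + (x.2 - a.2) ^ 2) < ε}

/-- `B_ε(Δ) = ⋃_{a ∈ Δ} B_ε(a)`. -/
def eballSet (ε : ℝ) (Δ : Set (ℝ × ℝ)) : Set (ℝ × ℝ) := ⋃ a ∈ Δ, eball ε a

/-- The separable lattice `αℤ × βℤ`. -/
def sepLattice (α β : ℝ) : Set (ℝ × ℝ) :=
  {p : ℝ × ℝ | ∃ k l : ℤ, p = (α * k, β * l)}

lemma coeFn_Mo (b : ℝ) (f : L2) :
    Mo b f =ᵐ[volume] fun x : ℝ => Complex.exp (2 * Real.pi * Complex.I * (b * x)) * f x :=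
  (memLp_modulate b f).coeFn_toLp

lemma coeFn_tf (z : ℝ × ℝ) (f : L2) :
    tf z f =ᵐ[volume] fun x : ℝ =>
      Complex.exp (2 * Real.pi * Complex.I * (z.2 * (x - z.1))) * f (x - z.1) := by
  have h := (measurePreserving_sub_right volume z.1).quasiMeasurePreserving.ae_eq_comp
    (coeFn_Mo z.2 f)
  filter_upwards [(memLp_translate z.1 (Mo z.2 f)).coeFn_toLp, h] with x h₁ h₂
  simp only [Function.comp_apply] at h₂
  rw [tf, Tr, h₁, h₂]
  push_cast
  rfl

lemma Tr_eq_compMeasurePreserving (a : ℝ) (f : L2) :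
    Tr a f = Lp.compMeasurePreserving (fun x : ℝ => x - a)
      (measurePreserving_sub_right volume a) f := by
  apply Lp.ext
  filter_upwards [(memLp_translate a f).coeFn_toLp,
    Lp.coeFn_compMeasurePreserving f (measurePreserving_sub_right volume a)] with x h₁ h₂
  rw [Tr, h₁, h₂, Function.comp_apply]

lemma norm_exp_two_pi_I_mul (b x : ℝ) :
    ‖Complex.exp (2 * Real.pi * Complex.I * (b * x))‖ = 1 := by
  have : Complex.exp (2 * Real.pi * Complex.I * (b * x))
      = Complex.exp ((2 * Real.pi * (b * x) : ℝ) * Complex.I) := by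
    push_cast; ring_nf
  rw [this, Complex.norm_exp_ofReal_mul_I]

lemma norm_Mo_le (b : ℝ) (f : L2) : ‖Mo b f‖ ≤ ‖f‖ := by
  apply Lp.norm_le_norm_of_ae_le
  filter_upwards [coeFn_Mo b f] with x hx
  rw [hx, norm_mul, norm_exp_two_pi_I_mul, one_mul]

lemma tf_add (z : ℝ × ℝ) (f h : L2) : tf z (f + h) = tf z f + tf z h := by
  have hs := (measurePreserving_sub_right volume z.1).quasiMeasurePreserving.ae_eq_comp
    (Lp.coeFn_add f h)
  apply Lp.ext
  filter_upwards [coeFn_tf z (f + h), coeFn_tf z f, coeFn_tf z h,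
    Lp.coeFn_add (tf z f) (tf z h), hs] with x h₁ h₂ h₃ h₄ h₅
  simp only [Function.comp_apply, Pi.add_apply] at h₅
  rw [h₁, h₄, Pi.add_apply, h₂, h₃, h₅, mul_add]

lemma tf_smul (z : ℝ × ℝ) (c : ℂ) (f : L2) : tf z (c • f) = c • tf z f := by
  have hs := (measurePreserving_sub_right volume z.1).quasiMeasurePreserving.ae_eq_comp
    (Lp.coeFn_smul c f)
  apply Lp.ext
  filter_upwards [coeFn_tf z (c • f), coeFn_tf z f, Lp.coeFn_smul c (tf z f), hs]
    with x h₁ h₂ h₃ h₄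
  simp only [Function.comp_apply, Pi.smul_apply] at h₄
  rw [h₁, h₃, Pi.smul_apply, h₂, h₄, smul_eq_mul, smul_eq_mul]
  ring

/-- The time-frequency shift `π(z)` as a continuous linear operator. -/
def tfCLM (z : ℝ × ℝ) : L2 →L[ℂ] L2 :=
  LinearMap.mkContinuous
    { toFun := tf z, map_add' := tf_add z, map_smul' := tf_smul z } 1 fun f => by
      change ‖Tr z.1 (Mo z.2 f)‖ ≤ 1 * ‖f‖
      rw [Tr_eq_compMeasurePreserving, Lp.norm_compMeasurePreserving, one_mul]
      exact norm_Mo_le _ _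

lemma tf_tf (z w : ℝ × ℝ) (f : L2) :
    tf z (tf w f) = Complex.exp (2 * Real.pi * Complex.I * (z.2 * w.1)) • tf (z + w) f := by
  have hs := (measurePreserving_sub_right volume z.1).quasiMeasurePreserving.ae_eq_comp
    (coeFn_tf w f)
  apply Lp.ext
  filter_upwards [coeFn_tf z (tf w f), coeFn_tf (z + w) f, hs,
    Lp.coeFn_smul (Complex.exp (2 * Real.pi * Complex.I * (z.2 * w.1))) (tf (z + w) f)]
    with x h₁ h₂ h₃ h₄
  simp only [Function.comp_apply] at h₃
  rw [h₁, h₃, h₄, Pi.smul_apply, h₂, smul_eq_mul, ← mul_assoc (Complex.exp _),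
    ← mul_assoc (Complex.exp _), ← Complex.exp_add, ← Complex.exp_add]
  congr 2
  · push_cast [Prod.fst_add, Prod.snd_add]
    ring
  · rw [Prod.fst_add, sub_sub]

lemma tf_zero (f : L2) : tf 0 f = f := by
  apply Lp.ext
  filter_upwards [coeFn_tf 0 f] with x hx
  rw [hx]
  simp

lemma continuous_Mo (f : L2) : Continuous fun b : ℝ => Mo b f := by
  refine continuous_iff_continuousAt.2 fun b₀ => ?_
  refine (Lp.tendsto_Lp_iff_tendsto_eLpNorm'' _ (fun b => memLp_modulate b f) _
    (memLp_modulate b₀ f)).2 ?_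
  have hkey : Tendsto (fun b : ℝ => ∫⁻ x : ℝ,
      ‖Complex.exp (2 * Real.pi * Complex.I * (b * x)) * f x -
        Complex.exp (2 * Real.pi * Complex.I * (b₀ * x)) * f x‖ₑ ^ (2 : ℝ)) (nhds b₀)
      (nhds (∫⁻ _ : ℝ, 0)) := by
    refine tendsto_lintegral_filter_of_dominated_convergence
      (fun x => ‖(2 : ℂ) * f x‖ₑ ^ (2 : ℝ)) ?_ ?_ ?_ ?_
    · have hf : Measurable f := (Lp.stronglyMeasurable f).measurable
      exact Eventually.of_forall fun b => by fun_prop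
    · refine Eventually.of_forall fun b => Eventually.of_forall fun x => ?_
      refine ENNReal.rpow_le_rpow ?_ (by norm_num)
      rw [enorm_le_iff_norm_le]
      refine (norm_sub_le _ _).trans ?_
      simp only [norm_mul, norm_exp_two_pi_I_mul, one_mul]
      norm_num
      linarith
    · have h := ((Lp.memLp f).const_mul (2 : ℂ)).2
      rw [eLpNorm_lt_top_iff_lintegral_rpow_enorm_lt_top (by norm_num) (by norm_num)] at h
      simpa using h.ne
    · refine Eventually.of_forall fun x => ?_
      have hc : Continuous fun b : ℝ =>
          ‖Complex.exp (2 * Real.pi * Complex.I * (b * x)) * f x -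
            Complex.exp (2 * Real.pi * Complex.I * (b₀ * x)) * f x‖ₑ ^ (2 : ℝ) := by
        refine (ENNReal.continuous_rpow_const).comp (continuous_enorm.comp ?_)
        fun_prop
      simpa using hc.tendsto b₀
  rw [lintegral_zero] at hkey
  have h := (ENNReal.continuous_rpow_const (y := 1 / 2)).tendsto 0 |>.comp hkey
  rw [ENNReal.zero_rpow_of_pos (by norm_num)] at h
  refine h.congr fun b => ?_
  rw [eLpNorm_eq_lintegral_rpow_enorm_toReal (by norm_num) (by norm_num)]
  simp [Function.comp_apply]

lemma continuous_tf (f : L2) : Continuous fun z : ℝ × ℝ => tf z f := by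
  let τ : C(ℝ × ℝ, C(ℝ, ℝ)) :=
    (ContinuousMap.mk (fun p : (ℝ × ℝ) × ℝ => p.2 - p.1.1) (by fun_prop)).curry
  have h := ((continuous_Mo f).comp continuous_snd).compMeasurePreservingLp τ.continuous
    (μ := volume) (fun z => measurePreserving_sub_right volume z.1) (by norm_num)
  refine h.congr fun z => ?_
  rw [tf, Tr_eq_compMeasurePreserving]
  rfl

lemma isClosed_stab {G : Set L2} (hG : IsClosed G) : IsClosed (stab G) := by
  have : stab G = ⋂ f ∈ G, (fun z => tf z f) ⁻¹' G := by
    ext z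
    simp [stab]
  rw [this]
  exact isClosed_biInter fun f _ => hG.preimage (continuous_tf f)

lemma zero_mem_stab (G : Set L2) : (0 : ℝ × ℝ) ∈ stab G := fun f hf => by rwa [tf_zero]

/-- `π(z + w)` and `π(z) π(w)` differ by a unimodular scalar, which a submodule does not see. -/
lemma tf_add_mem_iff (G : Submodule ℂ L2) (z w : ℝ × ℝ) (f : L2) :
    tf (z + w) f ∈ G ↔ tf z (tf w f) ∈ G := by
  rw [tf_tf, G.smul_mem_iff (Complex.exp_ne_zero _)]

lemma add_mem_stab (G : Submodule ℂ L2) {z w : ℝ × ℝ} (hz : z ∈ stab (G : Set L2))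
    (hw : w ∈ stab (G : Set L2)) : z + w ∈ stab (G : Set L2) := fun f hf =>
  (tf_add_mem_iff G z w f).2 (hz _ (hw f hf))

lemma gaborSpan_eq (g : L2) (Λ : Set (ℝ × ℝ)) :
    gaborSpan g Λ = (Submodule.span ℂ ((fun z => tf z g) '' Λ)).topologicalClosure :=
  rfl

lemma mem_stab_gaborSpan_of_forall {g : L2} {Λ : Set (ℝ × ℝ)} {z : ℝ × ℝ}
    (h : ∀ w ∈ Λ, tf (z + w) g ∈ gaborSpan g Λ) : z ∈ stab (gaborSpan g Λ) := by
  rw [gaborSpan_eq] at h ⊢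
  set G := (Submodule.span ℂ ((fun z => tf z g) '' Λ)).topologicalClosure
  have hle : Submodule.span ℂ ((fun z => tf z g) '' Λ) ≤ G.comap (tfCLM z : L2 →ₗ[ℂ] L2) := by
    rw [Submodule.span_le]
    rintro _ ⟨w, hw, rfl⟩
    exact (tf_add_mem_iff G z w g).1 (h w hw)
  exact Submodule.topologicalClosure_minimal _ hle
    ((Submodule.isClosed_topologicalClosure _).preimage (tfCLM z).continuous)

/-- A lattice is an additive subgroup with a compact set of coset representatives. -/
lemma IsLattice.exists_addSubgroup {Λ : Set (ℝ × ℝ)} (hΛ : IsLattice Λ) :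
    ∃ L : AddSubgroup (ℝ × ℝ), (L : Set (ℝ × ℝ)) = Λ ∧
      ∃ K : Set (ℝ × ℝ), IsCompact K ∧ ∀ z, ∃ w ∈ L, z - w ∈ K := by
  obtain ⟨A, hA, rfl⟩ := hΛ
  let φ : ℝ × ℝ → ℝ × ℝ := fun t =>
    (A 0 0 * t.1 + A 0 1 * t.2, A 1 0 * t.1 + A 1 1 * t.2)
  let L : AddSubgroup (ℝ × ℝ) :=
    { carrier := {p : ℝ × ℝ | ∃ k l : ℤ,
        p = (A 0 0 * k + A 0 1 * l, A 1 0 * k + A 1 1 * l)}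
      zero_mem' := ⟨0, 0, by ext <;> simp⟩
      add_mem' := by
        rintro _ _ ⟨k, l, rfl⟩ ⟨k', l', rfl⟩
        exact ⟨k + k', l + l', by ext <;> push_cast <;> simp <;> ring⟩
      neg_mem' := by
        rintro _ ⟨k, l, rfl⟩
        exact ⟨-k, -l, by ext <;> push_cast <;> simp <;> ring⟩ }
  refine ⟨L, rfl, φ '' (Set.Icc 0 1 ×ˢ Set.Icc 0 1),
    (isCompact_Icc.prod isCompact_Icc).image (by fun_prop), fun z => ?_⟩
  have hdet : A 0 0 * A 1 1 - A 0 1 * A 1 0 ≠ 0 := by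
    simpa [Matrix.det_fin_two] using hA.ne_zero
  obtain ⟨s, t, rfl⟩ : ∃ s t : ℝ, z = φ (s, t) := by
    refine ⟨(A 1 1 * z.1 - A 0 1 * z.2) / (A 0 0 * A 1 1 - A 0 1 * A 1 0),
      (A 0 0 * z.2 - A 1 0 * z.1) / (A 0 0 * A 1 1 - A 0 1 * A 1 0), ?_⟩
    ext <;> simp only [φ] <;>
      rw [mul_div_assoc', mul_div_assoc', ← add_div, eq_div_iff hdet] <;> ring
  refine ⟨φ (⌊s⌋, ⌊t⌋), ⟨⌊s⌋, ⌊t⌋, rfl⟩, (Int.fract s, Int.fract t), ?_, ?_⟩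
  · exact ⟨⟨Int.fract_nonneg s, (Int.fract_lt_one s).le⟩,
      ⟨Int.fract_nonneg t, (Int.fract_lt_one t).le⟩⟩
  · ext <;> simp only [φ, Prod.fst_sub, Prod.snd_sub, Int.fract] <;> ring

/-- A closed additive submonoid containing a cocompact subgroup is closed under negation. -/
lemma AddSubmonoid.neg_mem_of_isClosed_of_cocompact {E : Type*} [AddCommGroup E]
    [TopologicalSpace E] [IsTopologicalAddGroup E] [FirstCountableTopology E]
    (S : AddSubmonoid E) (hS : IsClosed (S : Set E)) (L : AddSubgroup E)
    (hL : ∀ w ∈ L, w ∈ S) (K : Set E) (hK : IsCompact K) (hLK : ∀ z, ∃ w ∈ L, z - w ∈ K)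
    {z : E} (hz : z ∈ S) : -z ∈ S := by
  choose w hwL hwK using fun n : ℕ => hLK (n • z)
  obtain ⟨a, -, φ, hφ, hlim⟩ := hK.tendsto_subseq hwK
  have hdiff := ((hlim.comp (tendsto_add_atTop_nat 1)).sub hlim).sub_const z
  rw [sub_self, zero_sub] at hdiff
  refine hS.mem_of_tendsto hdiff (Eventually.of_forall fun k => ?_)
  obtain ⟨m, hm⟩ := Nat.exists_eq_add_of_lt (hφ (Nat.lt_succ_self k))
  have hmem := S.add_mem (S.nsmul_mem hz m)
    (hL _ (L.sub_mem (hwL (φ k)) (hwL (φ (k + 1)))))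
  rw [SetLike.mem_coe]
  convert hmem using 1
  simp only [Function.comp_apply]
  rw [Nat.succ_eq_add_one] at hm
  rw [show φ (k + 1) • z = (φ k + m + 1) • z by rw [hm], add_nsmul, add_nsmul, one_nsmul]
  abel

/-- `z ∈ 𝔍(𝒢) ↔ π(z)g ∈ 𝒢`, and `𝔍(𝒢)` is a closed additive
subgroup of `ℝ²`. -/
theorem statement_0 (g : L2) (Λ : Set (ℝ × ℝ)) (hΛ : IsLattice Λ)
    (𝒢 : Set L2) (h𝒢 : 𝒢 = gaborSpan g Λ) :
    (∀ z : ℝ × ℝ, z ∈ stab 𝒢 ↔ tf z g ∈ 𝒢) ∧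
    IsClosed (stab 𝒢) ∧ (0 : ℝ × ℝ) ∈ stab 𝒢 ∧
    (∀ z w : ℝ × ℝ, z ∈ stab 𝒢 → w ∈ stab 𝒢 → z + w ∈ stab 𝒢) ∧
    (∀ z : ℝ × ℝ, z ∈ stab 𝒢 → -z ∈ stab 𝒢) := by
  subst h𝒢
  obtain ⟨L, rfl, K, hK, hLK⟩ := hΛ.exists_addSubgroup
  have hsub (w : ℝ × ℝ) (hw : w ∈ L) : tf w g ∈ gaborSpan g L :=
    subset_closure (Submodule.subset_span ⟨w, hw, rfl⟩)
  have hLstab (w : ℝ × ℝ) (hw : w ∈ L) : w ∈ stab (gaborSpan g L) :=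
    mem_stab_gaborSpan_of_forall fun v hv => hsub _ (L.add_mem hw hv)
  have hclosed : IsClosed (stab (gaborSpan g L)) := isClosed_stab isClosed_closure
  have hadd (z w : ℝ × ℝ) (hz : z ∈ stab (gaborSpan g L)) (hw : w ∈ stab (gaborSpan g L)) :
      z + w ∈ stab (gaborSpan g L) := by
    rw [gaborSpan_eq] at *
    exact add_mem_stab _ hz hw
  refine ⟨fun z => ⟨fun hz => hz g ?_, fun hz => mem_stab_gaborSpan_of_forall fun w hw => ?_⟩,
    hclosed, zero_mem_stab _, hadd, fun z hz => ?_⟩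
  · simpa only [tf_zero] using hsub 0 L.zero_mem
  · have := hLstab w hw _ hz
    rw [gaborSpan_eq] at this ⊢
    rw [add_comm]
    exact (tf_add_mem_iff _ w z g).2 this
  · let S : AddSubmonoid (ℝ × ℝ) :=
      { carrier := stab (gaborSpan g L)
        zero_mem' := zero_mem_stab _
        add_mem' := hadd _ _ }
    exact S.neg_mem_of_isClosed_of_cocompact hclosed L hLstab K hK hLK hz

end
end

section
/- Let g ∈ S₀(ℝ) with g ≠ 0, let α, β > 0, and suppose that (g, αℤ×βℤ) is a frame for its closed linear span 𝒢 = 𝒢(g, αℤ×βℤ). If M_ω f ∈ 𝒢 for every f ∈ 𝒢 and every ω ∈ ℝ (i.e. 𝒢 is invariant under all modulations), then 𝒢 = L²(ℝ). -/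
open MeasureTheory Complex Filter
open scoped ENNReal InnerProductSpace RealInnerProductSpace ComplexConjugate

noncomputable section

open scoped FourierTransform SchwartzMap

/-- The inverse Fourier transform of an integrable function is continuous. -/
lemma continuous_fourierInv_of_integrable {h : ℝ → ℂ} (hh : Integrable h) :
    Continuous (𝓕⁻ h) :=
  VectorFourier.fourierIntegral_continuous Real.continuous_fourierChar
    (continuous_inner (𝕜 := ℝ) (E := ℝ)).neg hh

open scoped ContDiff in
/-- Fourier inversion almost everywhere for integrable functions with integrable transform. -/
lemma ae_eq_fourierInv_fourier {h : ℝ → ℂ} (hh : Integrable h) (hh' : Integrable (𝓕 h)) :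
    h =ᵐ[volume] 𝓕⁻ (𝓕 h) := by
  refine ae_eq_of_integral_contDiff_smul_eq hh.locallyIntegrable
    (continuous_fourierInv_of_integrable hh').locallyIntegrable fun ψ hψ hψc => ?_
  have hc : HasCompactSupport (fun x => (ψ x : ℂ)) := hψc.comp_left Complex.ofReal_zero
  have hs : ContDiff ℝ ∞ (fun x => (ψ x : ℂ)) := Complex.ofRealCLM.contDiff.comp hψ
  set Ψ : 𝓢(ℝ, ℂ) := hc.toSchwartzMap hs
  have hΨv : ∀ x, Ψ x = (ψ x : ℂ) := fun x => rfl
  have e1 : ∫ ξ, 𝓕 (⇑(𝓕⁻ Ψ : 𝓢(ℝ, ℂ))) ξ • h ξ = ∫ x, (𝓕⁻ Ψ : 𝓢(ℝ, ℂ)) x • 𝓕 h x := by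
    simpa using! VectorFourier.integral_fourierIntegral_smul_eq_flip (L := innerₗ ℝ)
      Real.continuous_fourierChar continuous_inner (𝓕⁻ Ψ : 𝓢(ℝ, ℂ)).integrable hh
  have e2 : ∫ ξ, 𝓕⁻ (⇑Ψ) ξ • 𝓕 h ξ = ∫ x, Ψ x • 𝓕⁻ (𝓕 h) x := by
    have hflip : (-innerₗ ℝ : ℝ →ₗ[ℝ] ℝ →ₗ[ℝ] ℝ).flip = -innerₗ ℝ := by ext; simp
    have := VectorFourier.integral_fourierIntegral_smul_eq_flip (L := -innerₗ ℝ)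
      Real.continuous_fourierChar (continuous_inner (𝕜 := ℝ) (E := ℝ)).neg
      (Ψ.integrable (μ := volume)) hh'
    rw [hflip] at this
    exact this
  rw [← SchwartzMap.fourierInv_coe] at e2
  rw [← SchwartzMap.fourier_coe, FourierTransform.fourier_fourierInv_eq, e2] at e1
  simpa [hΨv] using e1

lemma Tr_coeFn (a : ℝ) (f : L2) : Tr a f =ᵐ[volume] fun x => f (x - a) :=
  MemLp.coeFn_toLp _

lemma Mo_coeFn (b : ℝ) (f : L2) :
    Mo b f =ᵐ[volume] fun x => Complex.exp (2 * Real.pi * Complex.I * (b * x)) * f x :=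
  MemLp.coeFn_toLp _

lemma ae_eq_comp_sub {E : Type*} {f h : ℝ → E} (H : f =ᵐ[volume] h) (a : ℝ) :
    (fun x => f (x - a)) =ᵐ[volume] fun x => h (x - a) :=
  (measurePreserving_sub_right volume a).quasiMeasurePreserving.ae_eq_comp H

lemma tf_coeFn (a b : ℝ) (f : L2) :
    tf (a, b) f =ᵐ[volume]
      fun x => Complex.exp (2 * Real.pi * Complex.I * (b * (x - a))) * f (x - a) := by
  filter_upwards [Tr_coeFn a (Mo b f), ae_eq_comp_sub (Mo_coeFn b f) a] with x h1 h2
  simp only [tf, h1, h2]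
  push_cast
  rfl

/-- The product of a conjugated translate with a second square integrable function is integrable. -/
lemma integrable_conj_translate_mul (g f : L2) (a : ℝ) :
    Integrable (fun x => conj (g (x - a)) * f x) volume := by
  have h := (memLp_translate a g).star
  exact (Lp.memLp f).integrable_mul h |>.congr (.of_forall fun x => by simp [mul_comm])

/-- The short-time Fourier transform as the Fourier transform of a windowed function. -/
lemma inner_tf (g f : L2) (a b : ℝ) :
    ⟪tf (a, b) g, f⟫_ℂ = Complex.exp (2 * Real.pi * Complex.I * (a * b)) *
      𝓕 (fun x => conj (g (x - a)) * f x) b := by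
  rw [L2.inner_def, Real.fourier_real_eq_integral_exp_smul, ← integral_const_mul]
  refine integral_congr_ae ?_
  filter_upwards [tf_coeFn a b g] with x hx
  rw [hx, RCLike.inner_apply, map_mul, ← Complex.exp_conj, smul_eq_mul]
  have : Complex.exp (2 * Real.pi * Complex.I * (a * b)) *
      Complex.exp (↑(-2 * Real.pi * x * b) * Complex.I) =
      Complex.exp (conj (2 * Real.pi * Complex.I * (b * (x - a)))) := by
    rw [← Complex.exp_add]
    congr 1
    simp [Complex.conj_ofNat]
    ring
  rw [← this]
  ring

lemma norm_inner_tf (g f : L2) (a b : ℝ) :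
    ‖⟪tf (a, b) g, f⟫_ℂ‖ = ‖𝓕 (fun x => conj (g (x - a)) * f x) b‖ := by
  rw [inner_tf, norm_mul]
  have : Complex.exp (2 * Real.pi * Complex.I * (a * b)) =
      Complex.exp ((2 * Real.pi * (a * b) : ℝ) * Complex.I) := by
    push_cast; ring_nf
  rw [this, Complex.norm_exp_ofReal_mul_I, one_mul]

lemma inner_Mo_tf_zero (g f : L2) (a ω : ℝ) :
    ⟪Mo ω (tf (a, 0) g), f⟫_ℂ = 𝓕 (fun x => conj (g (x - a)) * f x) ω := by
  rw [L2.inner_def, Real.fourier_real_eq_integral_exp_smul]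
  refine integral_congr_ae ?_
  filter_upwards [tf_coeFn a 0 g, Mo_coeFn ω (tf (a, 0) g)] with x hx hx'
  rw [hx', hx, RCLike.inner_apply, map_mul, ← Complex.exp_conj, smul_eq_mul]
  have : Complex.exp (↑(-2 * Real.pi * x * ω) * Complex.I) =
      Complex.exp (conj (2 * Real.pi * Complex.I * (ω * x))) := by
    congr 1
    simp [Complex.conj_ofNat]
    ring
  rw [← this]
  simp
  ring

/-- A function in the Feichtinger algebra has a continuous representative, and this
representative is dominated by a Gaussian-weighted integrable function. -/
lemma InS0.exists_continuous_rep {g : L2} (hg : InS0 g) :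
    ∃ γ : ℝ → ℂ, Continuous γ ∧ g =ᵐ[volume] γ ∧ ∃ v : ℝ → ℝ, Integrable v ∧
      ∀ᵐ a, ∀ x, Real.exp (-Real.pi * (x - a) ^ 2) * ‖γ x‖ ≤ v a := by
  set φ : ℝ → ℝ → ℂ := fun a x => (Real.exp (-Real.pi * (x - a) ^ 2) : ℂ) with hφ
  have hφ0 : ∀ a x, φ a x ≠ 0 := fun a x => by simp [hφ, Complex.exp_ne_zero]
  have hφc : ∀ a, Continuous (φ a) := fun a => Complex.continuous_ofReal.comp (by fun_prop)
  have hφae : ∀ a, (fun x => conj (gaussL2 (x - a)) * g x) =ᵐ[volume] fun x => φ a x * g x := by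
    intro a
    have : gaussL2 =ᵐ[volume] _ := memLp_gaussian.coeFn_toLp
    filter_upwards [ae_eq_comp_sub this a] with x hx
    rw [hx, Complex.conj_ofReal]
  have hint : ∀ a, Integrable (fun x => φ a x * g x) volume := fun a =>
    (integrable_conj_translate_mul gaussL2 g a).congr (hφae a)
  have hnorm : ∀ a b, ‖⟪tf (a, b) gaussL2, g⟫_ℂ‖ = ‖𝓕 (fun x => φ a x * g x) b‖ := by
    intro a b
    rw [norm_inner_tf, Real.fourier_congr_ae (hφae a)]
  have hF : ∀ᵐ a, Integrable (𝓕 (fun x => φ a x * g x)) volume := by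
    have h1 := Integrable.prod_right_ae (μ := (volume : Measure ℝ)) (ν := volume) hg
    filter_upwards [h1] with a ha
    refine ha.norm.mono' ?_ (.of_forall fun b => (hnorm a b).ge)
    exact (VectorFourier.fourierIntegral_continuous Real.continuous_fourierChar
      continuous_inner (hint a)).aestronglyMeasurable
  obtain ⟨a₀, ha₀⟩ := hF.exists
  set γ : ℝ → ℂ := fun x => 𝓕⁻ (𝓕 (fun x => φ a₀ x * g x)) x / φ a₀ x with hγ
  have hγc : Continuous γ := (continuous_fourierInv_of_integrable ha₀).div (hφc a₀) (hφ0 a₀)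
  have hgγ : g =ᵐ[volume] γ := by
    filter_upwards [ae_eq_fourierInv_fourier (hint a₀) ha₀] with x hx
    rw [hγ]
    simp only
    rw [← hx, mul_div_cancel_left₀ _ (hφ0 a₀ x)]
  refine ⟨γ, hγc, hgγ, fun a => ∫ b, ‖⟪tf (a, b) gaussL2, g⟫_ℂ‖,
    Integrable.integral_norm_prod_left (μ := (volume : Measure ℝ)) (ν := volume) hg,
    ?_⟩
  filter_upwards [hF] with a ha x
  have h1 : (fun x => φ a x * γ x) = 𝓕⁻ (𝓕 (fun x => φ a x * g x)) := by
    refine (Continuous.ae_eq_iff_eq volume ((hφc a).mul hγc)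
      (continuous_fourierInv_of_integrable ha)).1 ?_
    filter_upwards [ae_eq_fourierInv_fourier (hint a) ha, hgγ] with x hx hx'
    rw [← hx, hx', Pi.mul_apply]
  have h2 : ‖φ a x * γ x‖ ≤ ∫ b, ‖𝓕 (fun x => φ a x * g x) b‖ := by
    rw [show φ a x * γ x = 𝓕⁻ (𝓕 (fun x => φ a x * g x)) x from congrFun h1 x]
    exact VectorFourier.norm_fourierIntegral_le_integral_norm _ _ _ _ _
  simp only [hnorm]
  refine le_trans (le_of_eq ?_) h2
  rw [norm_mul, hφ, Complex.norm_real, Real.norm_eq_abs, Real.abs_exp]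

/-- A continuous function dominated as in `InS0.exists_continuous_rep` has a locally uniform
summable bound on its translates. -/
lemma exists_summable_translate_bound {γ : ℝ → ℂ} {v : ℝ → ℝ} (hv : Integrable v)
    (hb : ∀ᵐ a, ∀ x, Real.exp (-Real.pi * (x - a) ^ 2) * ‖γ x‖ ≤ v a)
    {α : ℝ} (hα : 0 < α) (R : ℝ) :
    ∃ u : ℤ → ℝ, Summable u ∧ ∀ (k : ℤ) (x : ℝ), |x| ≤ R → ‖γ (x - α * k)‖ ≤ u k := by
  set I : ℤ → Set ℝ := fun k => Set.Ioc (0 + k • α) (0 + (k + 1) • α) with hI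
  have hsum : Summable fun k => ∫ a in I k, v a :=
    (hasSum_integral_iUnion (fun _ => measurableSet_Ioc)
      (Set.pairwise_disjoint_Ioc_add_zsmul 0 α) hv.integrableOn).summable
  set c := Real.exp (-Real.pi * (R + α) ^ 2) with hc
  have hc0 : 0 < c := Real.exp_pos _
  refine ⟨fun k => (∫ a in I (-k), v a) / (c * α),
    ((Equiv.neg ℤ).summable_iff.2 hsum).div_const _, fun k x hx => ?_⟩
  rw [le_div_iff₀ (by positivity)]
  have hvol : volume.real (I (-k)) = α := by
    simp only [hI, Real.volume_real_Ioc, zsmul_eq_mul]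
    push_cast
    rw [max_eq_left (by linarith)]
    ring
  have hle : ∫ _ in I (-k), c * ‖γ (x - α * k)‖ ≤ ∫ a in I (-k), v a := by
    refine setIntegral_mono_on_ae ?_ hv.integrableOn measurableSet_Ioc ?_
    · exact integrableOn_const (by simp [hI])
    · filter_upwards [hb] with a ha hmem
      refine le_trans ?_ (ha (x - α * k))
      refine mul_le_mul_of_nonneg_right (Real.exp_le_exp.2 ?_) (norm_nonneg _)
      simp only [hI, Set.mem_Ioc, zsmul_eq_mul] at hmem
      push_cast at hmem
      have hx' := abs_le.1 hx
      have habs : |x - α * k - a| ≤ R + α := by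
        rw [abs_le]
        constructor <;> nlinarith [hmem.1, hmem.2]
      have := sq_le_sq' (abs_le.1 habs).1 (abs_le.1 habs).2
      nlinarith [Real.pi_pos]
  rw [setIntegral_const, hvol, smul_eq_mul] at hle
  linarith

/-- Square-summability and continuity of the periodization of `‖γ‖ ^ 2`. -/
lemma continuous_periodization {γ : ℝ → ℂ} (hγ : Continuous γ) {α : ℝ}
    (hb : ∀ R : ℝ, ∃ u : ℤ → ℝ, Summable u ∧
      ∀ (k : ℤ) (x : ℝ), |x| ≤ R → ‖γ (x - α * k)‖ ≤ u k) :
    (∀ x, Summable fun k : ℤ => ‖γ (x - α * k)‖ ^ 2) ∧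
      Continuous fun x => ∑' k : ℤ, ‖γ (x - α * k)‖ ^ 2 := by
  have hb2 : ∀ R : ℝ, 0 ≤ R → ∃ u : ℤ → ℝ, Summable u ∧
      ∀ (k : ℤ) (x : ℝ), |x| ≤ R → ‖γ (x - α * k)‖ ^ 2 ≤ u k := by
    intro R hR
    obtain ⟨u, hu, hle⟩ := hb R
    have hu0 : 0 ≤ u := fun k => (norm_nonneg _).trans (hle k 0 (by simpa using hR))
    refine ⟨fun k => u k * u k, (hu.mul_of_nonneg hu hu0 hu0).comp_injective
      (i := fun k : ℤ => (k, k)) (fun a b h => (Prod.mk.inj h).1), fun k x hx => ?_⟩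
    rw [sq]
    exact mul_le_mul (hle k x hx) (hle k x hx) (norm_nonneg _) (hu0 k)
  refine ⟨fun x => ?_, continuous_iff_continuousAt.2 fun x => ?_⟩
  · obtain ⟨u, hu, hle⟩ := hb2 |x| (abs_nonneg x)
    exact hu.of_nonneg_of_le (fun k => by positivity) fun k => hle k x le_rfl
  · obtain ⟨u, hu, hle⟩ := hb2 (|x| + 1) (by positivity)
    have hcont : ContinuousOn (fun x => ∑' k : ℤ, ‖γ (x - α * k)‖ ^ 2)
        {y | |y| ≤ |x| + 1} := by
      refine continuousOn_tsum (fun k => ?_) hu fun k y hy => ?_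
      · exact Continuous.continuousOn (by fun_prop)
      · rw [Real.norm_of_nonneg (by positivity)]
        exact hle k y hy
    refine hcont.continuousAt ?_
    filter_upwards [(isOpen_lt continuous_abs continuous_const).mem_nhds
      (show |x| < |x| + 1 by linarith)] with y hy
    exact le_of_lt hy

lemma sepLattice_eq_range (α β : ℝ) :
    sepLattice α β = Set.range fun p : ℤ × ℤ => ((α * p.1, β * p.2) : ℝ × ℝ) := by
  ext z
  simp [sepLattice, eq_comm]

lemma tsum_sepLattice {α β : ℝ} (hα : 0 < α) (hβ : 0 < β) (F : ℝ × ℝ → ℝ) :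
    ∑' z : sepLattice α β, F z = ∑' p : ℤ × ℤ, F (α * p.1, β * p.2) := by
  rw [sepLattice_eq_range]
  refine tsum_range (g := fun p : ℤ × ℤ => ((α * p.1, β * p.2) : ℝ × ℝ)) F ?_
  rintro ⟨k, l⟩ ⟨k', l'⟩ h
  simpa [hα.ne', hβ.ne'] using h

/-- Parseval's identity for the Fourier transform of a function supported in an interval of
length `1 / β`, sampled on `βℤ`. -/
lemma hasSum_sq_fourier_sample {h : ℝ → ℂ} {c β : ℝ} (hβ : 0 < β)
    (hs : ∀ x, x ∉ Set.Ioc c (c + 1 / β) → h x = 0) (hL2 : MemLp h 2 volume) :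
    HasSum (fun l : ℤ => ‖𝓕 h (β * l)‖ ^ 2) (1 / β * ∫ x, ‖h x‖ ^ 2) := by
  have hβ' : 0 < 1 / β := by positivity
  have hab : c < c + 1 / β := by linarith
  have key := (hasSum_sq_fourierCoeffOn hab (f := h) (hL2.mono_measure Measure.restrict_le_self)
    ).mul_left ((1 / β) ^ 2)
  have hint : ∫ x in c..(c + 1 / β), ‖h x‖ ^ 2 = ∫ x, ‖h x‖ ^ 2 := by
    rw [intervalIntegral.integral_of_le hab.le]
    exact setIntegral_eq_integral_of_forall_compl_eq_zero fun x hx => by simp [hs x hx]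
  have hval : 1 / β * ∫ x, ‖h x‖ ^ 2 =
      (1 / β) ^ 2 * (c + 1 / β - c)⁻¹ • ∫ x in c..(c + 1 / β), ‖h x‖ ^ 2 := by
    rw [hint, add_sub_cancel_left, smul_eq_mul]
    field_simp
  have hfun : (fun l : ℤ => ‖𝓕 h (β * l)‖ ^ 2) =
      fun l => (1 / β) ^ 2 * ‖fourierCoeffOn hab h l‖ ^ 2 := by
    ext l
    rw [fourierCoeffOn_eq_integral, Real.fourier_real_eq_integral_exp_smul, norm_smul, ← mul_pow,
      intervalIntegral.integral_of_le hab.le]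
    congr 1
    rw [setIntegral_eq_integral_of_forall_compl_eq_zero (fun x hx => by simp [hs x hx]),
      ← mul_assoc]
    have : 1 / β * ‖1 / (c + 1 / β - c)‖ = 1 := by
      rw [add_sub_cancel_left, one_div_one_div, Real.norm_of_nonneg hβ.le]
      field_simp
    rw [this, one_mul]
    congr 2
    ext x
    congr 1
    rw [fourier_coe_apply]
    congr 1
    push_cast
    rw [add_sub_cancel_left, div_div_eq_mul_div]
    ring
  rw [hfun, hval]
  exact key

/-- An upper bound for the frame sum at the indicator function of a short interval. -/
lemma tsum_frame_indicator_le {g F : L2} {γ : ℝ → ℂ} (hγ : Continuous γ) (hg : g =ᵐ[volume] γ)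
    {α β c d M : ℝ} (hα : 0 < α) (hβ : 0 < β) (hcd : c < d) (hd : d - c ≤ 1 / β)
    (hF : F =ᵐ[volume] (Set.Ioc c d).indicator 1)
    (hM : ∀ x ∈ Set.Ioc c d, ∀ s : Finset ℤ, ∑ k ∈ s, ‖γ (x - α * k)‖ ^ 2 ≤ M) :
    ∑' z : sepLattice α β, ‖⟪tf (z : ℝ × ℝ) g, F⟫_ℂ‖ ^ 2 ≤ 1 / β * (M * (d - c)) := by
  rw [tsum_sepLattice hα hβ fun z => ‖⟪tf z g, F⟫_ℂ‖ ^ 2]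
  set h : ℤ → ℝ → ℂ := fun k => (Set.Ioc c d).indicator fun x => conj (γ (x - α * k)) with hh
  have hcont : ∀ k : ℤ, Continuous fun x => conj (γ (x - α * k)) := fun k =>
    Complex.continuous_conj.comp (by fun_prop)
  have hae : ∀ k : ℤ, (fun x => conj (g (x - α * k)) * F x) =ᵐ[volume] h k := by
    intro k
    filter_upwards [ae_eq_comp_sub hg (α * k), hF] with x h1 h2
    rw [h1, h2, hh]
    by_cases hx : x ∈ Set.Ioc c d <;> simp [hx]
  have hL2 : ∀ k, MemLp (h k) 2 volume := by
    intro k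
    rw [hh, memLp_indicator_iff_restrict measurableSet_Ioc,
      memLp_two_iff_integrable_sq_norm (hcont k).aestronglyMeasurable]
    exact (Continuous.integrableOn_Icc ((hcont k).norm.pow 2)).mono_set Set.Ioc_subset_Icc_self
  have hrow : ∀ k : ℤ, HasSum (fun l : ℤ => ‖⟪tf (α * k, β * l) g, F⟫_ℂ‖ ^ 2)
      (1 / β * ∫ x, ‖h k x‖ ^ 2) := by
    intro k
    simp only [norm_inner_tf, Real.fourier_congr_ae (hae k)]
    refine hasSum_sq_fourier_sample (c := c) hβ (fun x hx => ?_) (hL2 k)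
    refine Set.indicator_of_notMem (fun hx' => hx ⟨hx'.1, hx'.2.trans (by linarith)⟩) _
  have hint : ∀ k, ∫ x, ‖h k x‖ ^ 2 = ∫ x in Set.Ioc c d, ‖γ (x - α * k)‖ ^ 2 := by
    intro k
    rw [← integral_indicator measurableSet_Ioc]
    congr 1
    ext x
    by_cases hx : x ∈ Set.Ioc c d <;> simp [hh, hx]
  have hintble : ∀ k : ℤ, IntegrableOn (fun x => ‖γ (x - α * k)‖ ^ 2) (Set.Ioc c d) := fun k =>
    (Continuous.integrableOn_Icc (by fun_prop)).mono_set Set.Ioc_subset_Icc_self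
  refine Real.tsum_le_of_sum_le (fun p => by positivity) fun u => ?_
  calc ∑ p ∈ u, ‖⟪tf (α * p.1, β * p.2) g, F⟫_ℂ‖ ^ 2
      ≤ ∑ p ∈ u.image Prod.fst ×ˢ u.image Prod.snd, ‖⟪tf (α * p.1, β * p.2) g, F⟫_ℂ‖ ^ 2 :=
        Finset.sum_le_sum_of_subset_of_nonneg Finset.subset_product fun _ _ _ => by positivity
    _ = ∑ k ∈ u.image Prod.fst, ∑ l ∈ u.image Prod.snd, ‖⟪tf (α * k, β * l) g, F⟫_ℂ‖ ^ 2 :=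
        Finset.sum_product _ _ _
    _ ≤ ∑ k ∈ u.image Prod.fst, 1 / β * ∫ x, ‖h k x‖ ^ 2 :=
        Finset.sum_le_sum fun k _ => sum_le_hasSum _ (fun _ _ => by positivity) (hrow k)
    _ = 1 / β * ∫ x in Set.Ioc c d, ∑ k ∈ u.image Prod.fst, ‖γ (x - α * k)‖ ^ 2 := by
        rw [← Finset.mul_sum, integral_finsetSum _ fun k _ => hintble k]
        simp only [hint]
    _ ≤ 1 / β * ∫ _ in Set.Ioc c d, M := by
        refine mul_le_mul_of_nonneg_left ?_ (by positivity)
        exact setIntegral_mono_on (integrable_finsetSum _ fun k _ => hintble k)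
          (integrableOn_const (by simp)) measurableSet_Ioc fun x hx => hM x hx _
    _ = 1 / β * (M * (d - c)) := by
        rw [setIntegral_const, Real.volume_real_Ioc_of_le hcd.le, smul_eq_mul, mul_comm M]

/-- Functions orthogonal to a modulation invariant Gabor space vanish wherever a translate of the
generator does not. -/
lemma ae_eq_zero_of_mem_orthogonal {g f : L2} {γ : ℝ → ℂ} (hg : g =ᵐ[volume] γ) {α β : ℝ}
    (hmod : ∀ f ∈ gaborSpan g (sepLattice α β), ∀ ω : ℝ, Mo ω f ∈ gaborSpan g (sepLattice α β))
    (hf : f ∈ (Submodule.span ℂ ((fun z => tf z g) '' sepLattice α β))ᗮ) :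
    ∀ᵐ x, (∃ k : ℤ, γ (x - α * k) ≠ 0) → f x = 0 := by
  have key : ∀ k : ℤ, ∀ᵐ x, conj (γ (x - α * k)) * f x = 0 := by
    intro k
    have hmem : tf (α * k, 0) g ∈ gaborSpan g (sepLattice α β) :=
      subset_closure (Submodule.subset_span ⟨_, ⟨k, 0, by simp⟩, rfl⟩)
    have hzero : 𝓕 (fun x => conj (g (x - α * k)) * f x) = 0 := by
      ext ω
      rw [← inner_Mo_tf_zero]
      rw [← Submodule.orthogonal_closure] at hf
      exact Submodule.inner_right_of_mem_orthogonal (hmod _ hmem ω) hf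
    have hinv := ae_eq_fourierInv_fourier (integrable_conj_translate_mul g f (α * k))
      (by rw [hzero]; exact integrable_zero _ _ _)
    filter_upwards [hinv, ae_eq_comp_sub hg (α * k)] with x hx hx'
    rw [hx', hzero, Real.fourierInv_eq] at hx
    simpa using hx
  filter_upwards [ae_all_iff.2 key] with x hx ⟨k, hk⟩
  simpa [hk] using hx k

/-- The indicator function of a set on which the translates of the generator have no common
zero belongs to the modulation invariant Gabor space. -/
lemma indicator_mem_gaborSpan {g F : L2} {γ : ℝ → ℂ} (hg : g =ᵐ[volume] γ) {α β : ℝ} {s : Set ℝ}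
    (hmod : ∀ f ∈ gaborSpan g (sepLattice α β), ∀ ω : ℝ, Mo ω f ∈ gaborSpan g (sepLattice α β))
    (hF : F =ᵐ[volume] s.indicator 1)
    (hs : ∀ x ∈ s, ∃ k : ℤ, γ (x - α * k) ≠ 0) :
    F ∈ gaborSpan g (sepLattice α β) := by
  change F ∈ (Submodule.span ℂ ((fun z => tf z g) '' sepLattice α β)).topologicalClosure
  rw [← Submodule.orthogonal_orthogonal_eq_closure, Submodule.mem_orthogonal]
  intro f hf
  rw [L2.inner_def]
  refine integral_eq_zero_of_ae ?_
  filter_upwards [ae_eq_zero_of_mem_orthogonal hg hmod hf, hF] with x hx hx'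
  by_cases hxs : x ∈ s
  · simp [hx (hs x hxs)]
  · simp [hx', hxs]

/-- a Gabor frame sequence over `αℤ×βℤ` with `S₀`-generator whose
span is invariant under all modulations spans all of `L²(ℝ)`. -/
theorem statement_4 (g : L2) (hg : InS0 g) (hg0 : g ≠ 0)
    (α β : ℝ) (hα : 0 < α) (hβ : 0 < β)
    (hframe : IsFrameSeq g (sepLattice α β))
    (hmod : ∀ f ∈ gaborSpan g (sepLattice α β), ∀ ω : ℝ,
      Mo ω f ∈ gaborSpan g (sepLattice α β)) :
    gaborSpan g (sepLattice α β) = Set.univ := by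
  obtain ⟨A, B, hA, -, hAB⟩ := hframe
  obtain ⟨γ, hγ, hgγ, v, hv, hb⟩ := hg.exists_continuous_rep
  obtain ⟨hsum, hcont⟩ := continuous_periodization hγ
    (exists_summable_translate_bound hv hb hα)
  set G : ℝ → ℝ := fun x => ∑' k : ℤ, ‖γ (x - α * k)‖ ^ 2 with hG
  have hG_pos : ∀ x, 0 < G x → ∃ k : ℤ, γ (x - α * k) ≠ 0 := by
    intro x hx
    by_contra! h
    simp [hG, h] at hx
  have hG_all : ∀ x, 0 < G x := by
    by_contra! h
    obtain ⟨x₁, hx₁⟩ : ∃ x, γ x ≠ 0 := by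
      by_contra! h
      refine hg0 ((Lp.eq_zero_iff_ae_eq_zero).2 ?_)
      filter_upwards [hgγ] with x hx
      rw [hx, h, Pi.zero_apply]
    have hx₁G : 0 < G x₁ :=
      (hsum x₁).tsum_pos (fun k => by positivity) 0
        (by simpa using pow_pos (norm_pos_iff.2 hx₁) 2)
    have hAβ : 0 < A * β := mul_pos hA hβ
    obtain ⟨x₀, hx₀⟩ := h
    obtain ⟨x₂, hx₂⟩ : min (G x₁) (A * β / 2) ∈ Set.range G :=
      mem_range_of_exists_le_of_exists_ge hcont
        ⟨x₀, hx₀.trans (le_min hx₁G.le (by positivity))⟩ ⟨x₁, min_le_left _ _⟩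
    have hx₂pos : 0 < G x₂ := hx₂ ▸ lt_min hx₁G (by positivity)
    have hx₂lt : G x₂ < 3 / 4 * (A * β) :=
      (hx₂ ▸ min_le_right (G x₁) (A * β / 2) : G x₂ ≤ A * β / 2).trans_lt (by linarith)
    obtain ⟨ε, hε, hball⟩ := Metric.mem_nhds_iff.1 (((isOpen_lt continuous_const hcont).inter
      (isOpen_lt hcont continuous_const)).mem_nhds ⟨hx₂pos, hx₂lt⟩)
    set δ := min (ε / 2) (1 / β) with hδ
    have hδ0 : 0 < δ := by positivity
    have hIoc : ∀ x ∈ Set.Ioc x₂ (x₂ + δ), 0 < G x ∧ G x < 3 / 4 * (A * β) := by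
      intro x hx
      refine hball ?_
      rw [Metric.mem_ball, Real.dist_eq, abs_of_pos (by linarith [hx.1])]
      linarith [hx.2, min_le_left (ε / 2) (1 / β)]
    set F : L2 := indicatorConstLp 2 (measurableSet_Ioc (a := x₂) (b := x₂ + δ))
      (by simp) (1 : ℂ) with hFdef
    have hF : F =ᵐ[volume] (Set.Ioc x₂ (x₂ + δ)).indicator 1 := indicatorConstLp_coeFn
    have hFnorm : ‖F‖ ^ 2 = δ := by
      rw [hFdef, norm_indicatorConstLp (by simp) (by simp), norm_one, one_mul,
        Real.volume_real_Ioc_of_le (by linarith), add_sub_cancel_left, ENNReal.toReal_ofNat,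
        ← Real.sqrt_eq_rpow, Real.sq_sqrt hδ0.le]
    have hlow := (hAB F (indicator_mem_gaborSpan hgγ hmod hF
      fun x hx => hG_pos x (hIoc x hx).1)).1
    have hup := tsum_frame_indicator_le (M := 3 / 4 * (A * β)) hγ hgγ hα hβ
      (by linarith : x₂ < x₂ + δ) (by linarith [min_le_right (ε / 2) (1 / β)]) hF
      fun x hx s => ((hsum x).sum_le_tsum s fun k _ => by positivity).trans (hIoc x hx).2.le
    have hcomb := hlow.trans hup
    rw [hFnorm, add_sub_cancel_left,
      show 1 / β * (3 / 4 * (A * β) * δ) = 3 / 4 * (A * δ) by field_simp] at hcomb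
    nlinarith [mul_pos hA hδ0]
  have htop : (Submodule.span ℂ ((fun z => tf z g) '' sepLattice α β)).topologicalClosure = ⊤ := by
    rw [Submodule.topologicalClosure_eq_top_iff, Submodule.eq_bot_iff]
    intro f hf
    refine (Lp.eq_zero_iff_ae_eq_zero).2 ?_
    filter_upwards [ae_eq_zero_of_mem_orthogonal hgγ hmod hf] with x hx
    exact hx (hG_pos x (hG_all x))
  change ((Submodule.span ℂ ((fun z => tf z g) '' sepLattice α β)).topologicalClosure : Set L2) = _
  rw [htop, Submodule.top_coe]

end
end
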